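/- For all real x > 1, 0 > Σ_{p > x} (log(1 - 1/p) + 1/p) > -1.02/((x-1) · log x), where the sum is over primes p > x. -/

import Mathlib

open Real

lemma aux_cb (n : ℕ) (hn : 1 ≤ n) : 2 * n.centralBinom ≤ 4 ^ n := by
  induction n, hn using Nat.le_induction with
  | base => simp [Nat.centralBinom_eq_two_mul_choose]
  | succ n hn ih =>
    have h := Nat.succ_mul_centralBinom_succ n
    have : (n + 1) * (2 * (n+1).centralBinom) ≤ (n + 1) * 4 ^ (n+1) := by
      rw [pow_succ]; nlinarith
    exact Nat.le_of_mul_le_mul_left this (Nat.succ_pos n)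

lemma aux_primes (n : ℕ) (hn : 1 ≤ n) :
    ∑ p ∈ (Finset.Ioc n (2 * n)).filter Nat.Prime, Real.log p ≤ Real.log 4 * (n - 1 / 2) := by
  have hd : (∏ p ∈ (Finset.Ioc n (2 * n)).filter Nat.Prime, p) ∣ n.centralBinom := by
    apply Finset.prod_primes_dvd
    · intro p hp
      exact (Finset.mem_filter.1 hp).2.prime
    · intro p hp
      obtain ⟨h1, h2⟩ := Finset.mem_filter.1 hp
      obtain ⟨h3, h4⟩ := Finset.mem_Ioc.1 h1
      rw [Nat.centralBinom_eq_two_mul_choose]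
      exact h2.dvd_choose h3 (by omega) h4
  have hle := (Nat.le_of_dvd (Nat.centralBinom_pos n) hd)
  have h2 : 2 * (∏ p ∈ (Finset.Ioc n (2 * n)).filter Nat.Prime, p) ≤ 4 ^ n :=
    (Nat.mul_le_mul_left 2 hle).trans (aux_cb n hn)
  have hne : ∀ p ∈ (Finset.Ioc n (2 * n)).filter Nat.Prime, (p : ℝ) ≠ 0 := by
    intro p hp
    exact_mod_cast (Finset.mem_filter.1 hp).2.ne_zero
  rw [← Real.log_prod hne]
  have h3 : (2 : ℝ) * (∏ p ∈ (Finset.Ioc n (2 * n)).filter Nat.Prime, (p : ℝ)) ≤ 4 ^ n := by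
    have h := (Nat.cast_le (α := ℝ)).2 h2
    push_cast at h
    exact h
  have hpne := Finset.prod_ne_zero_iff.2 hne
  have hpos : 0 < (∏ p ∈ (Finset.Ioc n (2 * n)).filter Nat.Prime, (p : ℝ)) :=
    lt_of_le_of_ne (Finset.prod_nonneg fun i _ => by positivity) hpne.symm
  have h4 := Real.log_le_log (by positivity) h3
  rw [Real.log_mul (by norm_num) hpne, Real.log_pow] at h4
  have h5 : Real.log 4 = 2 * Real.log 2 := by
    rw [show (4 : ℝ) = 2 ^ 2 by norm_num, Real.log_pow]; norm_num
  have h6 : Real.log 4 * ((n : ℝ) - 1 / 2) = n * Real.log 4 - Real.log 2 := by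
    rw [h5]; ring
  linarith

lemma aux_coef (M p K : ℕ) (hM : 1 ≤ M) (hp : p.Prime) (h1 : 2 * M + 1 ≤ p) (h2 : p ≤ K) :
    ∑ n ∈ (Finset.Ico (M + 1) (K + 1)).filter (fun n => n < p ∧ p ≤ 2 * n),
      1 / (((n : ℝ) - 1) * n * (n + 1)) = (3 * p - 1) / (2 * p * (p - 1) * (p + 1)) := by
  obtain ⟨k, rfl⟩ : Odd p := hp.odd_of_ne_two (by omega)
  have e : (Finset.Ico (M + 1) (K + 1)).filter (fun n => n < 2 * k + 1 ∧ 2 * k + 1 ≤ 2 * n)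
      = Finset.Ico (k + 1) (2 * k + 1) := by
    ext n; simp only [Finset.mem_filter, Finset.mem_Ico]; omega
  have key : ∀ b, k + 1 ≤ b → ∑ n ∈ Finset.Ico (k + 1) b, 1 / (((n : ℝ) - 1) * n * (n + 1)) =
      1 / 2 * (1 / ((k : ℝ) * (k + 1)) - 1 / (((b : ℝ) - 1) * b)) := by
    intro b hb
    induction b, hb using Nat.le_induction with
    | base => simp
    | succ b hb ih =>
      rw [Finset.sum_Ico_succ_top hb, ih]
      have hk : (1 : ℝ) ≤ k := by exact_mod_cast (show 1 ≤ k by omega)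
      have hb1 : (k : ℝ) + 1 ≤ b := by exact_mod_cast hb
      have : (b : ℝ) - 1 ≠ 0 := by linarith
      have : (b : ℝ) ≠ 0 := by linarith
      push_cast
      rw [add_sub_cancel_right]
      field_simp
      ring
  rw [e, key _ (by omega)]
  have hk : (1 : ℝ) ≤ k := by exact_mod_cast (show 1 ≤ k by omega)
  push_cast
  rw [add_sub_cancel_right]
  have : (k : ℝ) ≠ 0 := by linarith
  field_simp
  ring

lemma aux_tel (M K : ℕ) (hM : 1 ≤ M) (hK : M ≤ K) :
    ∑ n ∈ Finset.Ico (M + 1) (K + 1), 1 / (((n : ℝ) - 1) * n * (n + 1)) * (n - 1 / 2) =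
      (4 * M + 1) / (4 * M * (M + 1)) - (4 * K + 1) / (4 * K * (K + 1)) := by
  induction K, hK using Nat.le_induction with
  | base => simp
  | succ b hb ih =>
    rw [Finset.sum_Ico_succ_top (by omega), ih]
    have hb1 : (M : ℝ) ≤ b := by exact_mod_cast hb
    have hk : (1 : ℝ) ≤ M := by exact_mod_cast hM
    have : (b : ℝ) ≠ 0 := by linarith
    push_cast
    rw [add_sub_cancel_right]
    field_simp
    ring

lemma aux_log4 : Real.log 4 ≤ 1.3863 := by
  have h5 : Real.log 4 = 2 * Real.log 2 := by
    rw [show (4 : ℝ) = 2 ^ 2 by norm_num, Real.log_pow]; norm_num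
  have := Real.log_two_lt_d9
  rw [h5]; linarith

lemma aux_odd (M K : ℕ) (hM : 1 ≤ M) :
    ∑ p ∈ (Finset.Icc (2 * M + 1) K).filter Nat.Prime, Real.log p / ((p : ℝ) * (p - 1))
      ≤ 2.04 / (2 * M) := by
  have hM1 : (1 : ℝ) ≤ M := by exact_mod_cast hM
  rcases le_or_gt K M with hK | hK
  · rw [Finset.Icc_eq_empty (by omega)]
    simp; positivity
  have hw : ∀ n ∈ Finset.Ico (M + 1) (K + 1), 0 ≤ 1 / (((n : ℝ) - 1) * n * (n + 1)) := by
    intro n hn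
    have : (1 : ℝ) ≤ n := by exact_mod_cast (show 1 ≤ n by have := Finset.mem_Ico.1 hn; omega)
    have : (0 : ℝ) ≤ (n : ℝ) - 1 := by linarith
    positivity
  have A : ∑ p ∈ (Finset.Icc (2 * M + 1) K).filter Nat.Prime,
      Real.log p * ((3 * p - 1) / (2 * p * (p - 1) * (p + 1)))
      ≤ Real.log 4 * ((4 * M + 1) / (4 * M * (M + 1))) := by
    calc _ = ∑ p ∈ (Finset.Icc (2 * M + 1) K).filter Nat.Prime,
        ∑ n ∈ Finset.Ico (M + 1) (K + 1), if n < p ∧ p ≤ 2 * n then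
          Real.log p * (1 / (((n : ℝ) - 1) * n * (n + 1))) else 0 := by
          refine Finset.sum_congr rfl fun p hp => ?_
          obtain ⟨h1, h2⟩ := Finset.mem_filter.1 hp
          obtain ⟨h3, h4⟩ := Finset.mem_Icc.1 h1
          rw [← aux_coef M p K hM h2 h3 h4, Finset.mul_sum, Finset.sum_filter]
      _ = ∑ n ∈ Finset.Ico (M + 1) (K + 1), ∑ p ∈ (Finset.Icc (2 * M + 1) K).filter Nat.Prime,
          if n < p ∧ p ≤ 2 * n then
          Real.log p * (1 / (((n : ℝ) - 1) * n * (n + 1))) else 0 := Finset.sum_comm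
      _ ≤ ∑ n ∈ Finset.Ico (M + 1) (K + 1),
          Real.log 4 * (1 / (((n : ℝ) - 1) * n * (n + 1)) * (n - 1 / 2)) := by
          refine Finset.sum_le_sum fun n hn => ?_
          rw [← Finset.sum_filter, ← Finset.sum_mul]
          have h1 := aux_primes n (by have := Finset.mem_Ico.1 hn; omega)
          have h2 : ∑ p ∈ ((Finset.Icc (2 * M + 1) K).filter Nat.Prime).filter
              (fun p => n < p ∧ p ≤ 2 * n), Real.log p ≤
              ∑ p ∈ (Finset.Ioc n (2 * n)).filter Nat.Prime, Real.log p := by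
            apply Finset.sum_le_sum_of_subset_of_nonneg
            · intro p hp
              simp only [Finset.mem_filter, Finset.mem_Icc, Finset.mem_Ioc] at hp ⊢
              tauto
            · intro p _ _
              exact Real.log_natCast_nonneg p
          have := mul_le_mul_of_nonneg_right (h2.trans h1) (hw n hn)
          linarith
      _ = Real.log 4 * ((4 * M + 1) / (4 * M * (M + 1)) - (4 * K + 1) / (4 * K * (K + 1))) := by
          rw [← Finset.mul_sum, aux_tel M K hM hK.le]
      _ ≤ _ := by
          apply mul_le_mul_of_nonneg_left _ (Real.log_nonneg (by norm_num))
          have : (0 : ℝ) ≤ (4 * K + 1) / (4 * K * (K + 1)) := by positivity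
          linarith
  have B : (3 * M + 1) / (2 * (M + 1)) *
      ∑ p ∈ (Finset.Icc (2 * M + 1) K).filter Nat.Prime, Real.log p / ((p : ℝ) * (p - 1)) ≤
      ∑ p ∈ (Finset.Icc (2 * M + 1) K).filter Nat.Prime,
      Real.log p * ((3 * p - 1) / (2 * p * (p - 1) * (p + 1))) := by
    rw [Finset.mul_sum]
    refine Finset.sum_le_sum fun p hp => ?_
    obtain ⟨h1, h2⟩ := Finset.mem_filter.1 hp
    have h3 : (2 : ℝ) * M + 1 ≤ p := by exact_mod_cast (Finset.mem_Icc.1 h1).1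
    have h4 : (0 : ℝ) < (p : ℝ) - 1 := by linarith
    have h5 : (0 : ℝ) < p := by linarith
    have h6 : Real.log p * ((3 * p - 1) / (2 * p * (p - 1) * (p + 1))) =
      (3 * p - 1) / (2 * (p + 1)) * (Real.log p / ((p : ℝ) * (p - 1))) := by
      field_simp
    rw [h6]
    apply mul_le_mul_of_nonneg_right
    · rw [div_le_div_iff₀ (by positivity) (by positivity)]
      nlinarith
    · have := Real.log_natCast_nonneg p
      positivity
  have C := B.trans A
  set S := ∑ p ∈ (Finset.Icc (2 * M + 1) K).filter Nat.Prime, Real.log p / ((p : ℝ) * (p - 1))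
  have hL := aux_log4
  have D : Real.log 4 * ((4 * M + 1) / (4 * M * (M + 1))) ≤
      (3 * M + 1) / (2 * (M + 1)) * (2.04 / (2 * M)) := by
    have : (3 * (M : ℝ) + 1) / (2 * (M + 1)) * (2.04 / (2 * M)) =
      (2.04 * (3 * M + 1)) / (4 * M * (M + 1)) := by field_simp; ring
    rw [this, ← mul_div_assoc]
    apply div_le_div_of_nonneg_right _ (by positivity)
    nlinarith
  exact le_of_mul_le_mul_left (C.trans D) (by positivity)

lemma aux_all (m K : ℕ) (hm : 2 ≤ m) :
    ∑ p ∈ (Finset.Icc m K).filter Nat.Prime, Real.log p / ((p : ℝ) * (p - 1))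
      ≤ 2.04 / ((m : ℝ) - 1) := by
  have hnn : ∀ p : ℕ, 0 ≤ Real.log p / ((p : ℝ) * (p - 1)) := by
    intro p
    rcases Nat.eq_zero_or_pos p with rfl | hp
    · simp
    have := Real.log_natCast_nonneg p
    have h : (1 : ℝ) ≤ p := by exact_mod_cast hp
    have : (0 : ℝ) ≤ (p : ℝ) - 1 := by linarith
    positivity
  rcases Nat.even_or_odd' m with ⟨k, rfl | rfl⟩
  · rcases Nat.lt_or_ge k 2 with hk | hk
    · obtain rfl : k = 1 := by omega
      have h := aux_odd 1 K le_rfl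
      have : ∑ p ∈ (Finset.Icc (2 * 1) K).filter Nat.Prime, Real.log p / ((p : ℝ) * (p - 1)) ≤
          ∑ p ∈ insert 2 ((Finset.Icc (2 * 1 + 1) K).filter Nat.Prime),
            Real.log p / ((p : ℝ) * (p - 1)) := by
        apply Finset.sum_le_sum_of_subset_of_nonneg
        · intro p hp
          simp only [Finset.mem_filter, Finset.mem_Icc, Finset.mem_insert] at hp ⊢
          by_cases h : p = 2
          · exact Or.inl h
          · exact Or.inr ⟨⟨by omega, hp.1.2⟩, hp.2⟩
        · intro p _ _; exact hnn p
      rw [Finset.sum_insert (by simp)] at this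
      have h2 := Real.log_two_lt_d9
      norm_num at this h ⊢
      linarith
    · have h := aux_odd k K (by omega)
      have e : ∑ p ∈ (Finset.Icc (2 * k) K).filter Nat.Prime, Real.log p / ((p : ℝ) * (p - 1)) ≤
          ∑ p ∈ ((Finset.Icc (2 * k + 1) K).filter Nat.Prime),
            Real.log p / ((p : ℝ) * (p - 1)) := by
        apply Finset.sum_le_sum_of_subset_of_nonneg
        · intro p hp
          simp only [Finset.mem_filter, Finset.mem_Icc] at hp ⊢
          obtain ⟨j, hj⟩ := hp.2.odd_of_ne_two (by omega)
          exact ⟨⟨by omega, hp.1.2⟩, hp.2⟩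
        · intro p _ _; exact hnn p
      refine e.trans (h.trans ?_)
      have : (2 : ℝ) ≤ k := by exact_mod_cast hk
      push_cast
      apply div_le_div_of_nonneg_left (by norm_num) (by linarith) (by linarith)
  · have h := aux_odd k K (by omega)
    push_cast
    rw [add_sub_cancel_right]
    exact h

lemma aux_g (p : ℕ) (hp : 2 ≤ p) :
    0 < -(Real.log (1 - 1 / (p : ℝ)) + 1 / (p : ℝ)) ∧
    -(Real.log (1 - 1 / (p : ℝ)) + 1 / (p : ℝ)) ≤ 1 / (2 * p * (p - 1)) := by
  have h : (2 : ℝ) ≤ p := by exact_mod_cast hp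
  have h1 : (0 : ℝ) < (p : ℝ) - 1 := by linarith
  have h0 : (0 : ℝ) < p := by linarith
  have hq : 1 - 1 / (p : ℝ) = (p - 1) / p := by field_simp
  have hpos : 0 < 1 - 1 / (p : ℝ) := by rw [hq]; positivity
  constructor
  · have := Real.log_lt_sub_one_of_pos hpos (by
      have : 0 < 1 / (p : ℝ) := by positivity
      linarith)
    linarith
  · have hz : 0 < (1 - 1 / (p : ℝ))⁻¹ := by positivity
    have h3 : 0 ≤ Real.log (1 - 1 / (p : ℝ))⁻¹ := by
      apply Real.log_nonneg
      apply (one_le_inv₀ hpos).2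
      have : 0 < 1 / (p : ℝ) := by positivity
      linarith
    have h4 := Real.self_le_sinh_iff.2 h3
    rw [Real.sinh_log hz, inv_inv, Real.log_inv, hq] at h4
    rw [hq]
    have : ((((p : ℝ) - 1) / p)⁻¹ - (p - 1) / p) / 2 = 1 / p + 1 / (2 * p * (p - 1)) := by
      field_simp; ring
    linarith

theorem rosser_schoenfeld_tail (x : ℝ) (hx : 1 < x) :
    0 > (∑' p : {p : ℕ // p.Prime ∧ x < p}, (Real.log (1 - 1 / (p : ℝ)) + 1 / (p : ℝ))) ∧
    (∑' p : {p : ℕ // p.Prime ∧ x < p}, (Real.log (1 - 1 / (p : ℝ)) + 1 / (p : ℝ)))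
      > -1.02 / ((x - 1) * Real.log x) := by
  set m : ℕ := ⌊x⌋₊ + 1 with hm
  have hxm : x < m := by rw [hm]; push_cast; exact Nat.lt_floor_add_one x
  have hm2 : 2 ≤ m := by
    have : 1 < m := by exact_mod_cast hx.trans hxm
    omega
  have hmr : (2 : ℝ) ≤ m := by exact_mod_cast hm2
  let g : {p : ℕ // p.Prime ∧ x < p} → ℝ := fun p => -(Real.log (1 - 1 / (p : ℝ)) + 1 / (p : ℝ))
  have hlogm : 0 < Real.log m := Real.log_pos (by linarith)
  have hg0 : ∀ p, 0 < g p := fun p => (aux_g p p.2.1.two_le).1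
  have hfin : ∀ s : Finset {p : ℕ // p.Prime ∧ x < p},
      ∑ p ∈ s, g p ≤ 1.02 / (((m : ℝ) - 1) * Real.log m) := by
    intro s
    have hle : ∀ p ∈ s, g p ≤ 1 / (2 * Real.log m) *
        (Real.log ((p : ℕ) : ℝ) / (((p : ℕ) : ℝ) * (((p : ℕ) : ℝ) - 1))) := by
      intro p _
      refine (aux_g p p.2.1.two_le).2.trans ?_
      have h1 : m ≤ (p : ℕ) := by
        have := (Nat.floor_lt (by linarith)).2 p.2.2
        omega
      have h2 : (m : ℝ) ≤ ((p : ℕ) : ℝ) := by exact_mod_cast h1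
      have h3 := Real.log_le_log (by linarith) h2
      have h4 : (0 : ℝ) < ((p : ℕ) : ℝ) - 1 := by linarith
      have h5 : (0 : ℝ) < ((p : ℕ) : ℝ) := by linarith
      rw [div_mul_div_comm, div_le_div_iff₀ (by positivity) (by positivity)]
      have : 0 < 2 * ((p : ℕ) : ℝ) * (((p : ℕ) : ℝ) - 1) := by positivity
      nlinarith
    have hsub : ∑ p ∈ s, (Real.log ((p : ℕ) : ℝ) / (((p : ℕ) : ℝ) * (((p : ℕ) : ℝ) - 1))) ≤
        2.04 / ((m : ℝ) - 1) := by
      have e := Finset.sum_map s (Function.Embedding.subtype _)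
        (fun p : ℕ => Real.log p / ((p : ℝ) * (p - 1)))
      refine le_trans e.symm.le ?_
      refine le_trans ?_ (aux_all m ((s.map (Function.Embedding.subtype _)).sup id) hm2)
      apply Finset.sum_le_sum_of_subset_of_nonneg
      · intro p hp
        have hp' := hp
        rw [Finset.mem_map] at hp'
        obtain ⟨q, hq, rfl⟩ := hp'
        rw [Finset.mem_filter, Finset.mem_Icc]
        refine ⟨⟨?_, Finset.le_sup (f := id) hp⟩, q.2.1⟩
        have := (Nat.floor_lt (by linarith)).2 q.2.2
        exact this
      · intro p hp _
        have h1 := (Finset.mem_Icc.1 (Finset.mem_filter.1 hp).1).1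
        have h2 : (m : ℝ) ≤ p := by exact_mod_cast h1
        have h4 : (0 : ℝ) < (p : ℝ) - 1 := by linarith
        have := Real.log_natCast_nonneg p
        positivity
    calc _ ≤ _ := Finset.sum_le_sum hle
      _ = 1 / (2 * Real.log m) * _ := by rw [← Finset.mul_sum]
      _ ≤ 1 / (2 * Real.log m) * (2.04 / ((m : ℝ) - 1)) :=
        mul_le_mul_of_nonneg_left hsub (by positivity)
      _ = _ := by
        have : (m : ℝ) - 1 ≠ 0 := by linarith
        field_simp
        norm_num
  have hsum : Summable g := summable_of_sum_le (fun p => (hg0 p).le) hfin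
  have hle : ∑' p, g p ≤ 1.02 / (((m : ℝ) - 1) * Real.log m) :=
    Real.tsum_le_of_sum_le (fun p => (hg0 p).le) hfin
  obtain ⟨q, hq1, hq2⟩ := Nat.exists_infinite_primes m
  have hpos : 0 < ∑' p, g p :=
    hsum.tsum_pos (fun p => (hg0 p).le)
      ⟨q, hq2, hxm.trans_le (by exact_mod_cast hq1)⟩ (hg0 _)
  have hneg : ∑' p, g p = -∑' p : {p : ℕ // p.Prime ∧ x < p},
      (Real.log (1 - 1 / (p : ℝ)) + 1 / (p : ℝ)) := tsum_neg
  have hlogx : 0 < Real.log x := Real.log_pos hx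
  have hlt : 1.02 / (((m : ℝ) - 1) * Real.log m) < 1.02 / ((x - 1) * Real.log x) := by
    have hx1 : 0 < x - 1 := by linarith
    have := Real.log_lt_log (by linarith) hxm
    apply div_lt_div_of_pos_left (by norm_num) (by positivity)
    apply mul_lt_mul'' (by linarith) this hx1.le hlogx.le
  rw [neg_div]
  constructor <;> linarith
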